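/- Existence of sparse colourings for bounded-degree interpretations: Let I be an interpretation such that for every element x the set of elements adjacent to x is finite with at most d elements (d : ℕ), let F ⊆ α_I be any subset, and let ℓ : ℕ. Then there exists a partial colouring κ : α_I → Option ℕ whose set of coloured elements is exactly F, such that (I,κ) is ℓ-sparse and κ uses at most 1 + d + d² + ⋯ + d^{2ℓ} distinct colours (every colour used lies below this bound). -/

import Mathlib

/-- An interpretation with concept names `Cn` and role names `Rn`. -/
structure Interp (Cn Rn : Type) where
  α : Type
  A : Cn → Set α
  r : Rn → α → α → Prop

namespace Interp

variable {Cn Rn Γ : Type}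

/-- A homomorphism of interpretations. -/
def IsHom (I J : Interp Cn Rn) (h : I.α → J.α) : Prop :=
  (∀ (c : Cn) (a : I.α), a ∈ I.A c → h a ∈ J.A c) ∧
  (∀ (s : Rn) (a b : I.α), I.r s a b → J.r s (h a) (h b))

/-- Adjacency: related by some role in either direction. -/
def Adj (I : Interp Cn Rn) (x y : I.α) : Prop :=
  ∃ s, I.r s x y ∨ I.r s y x

/-- There is a walk of length `n` from `x` to `y` along adjacent elements. -/
def ChainLen (I : Interp Cn Rn) (n : ℕ) (x y : I.α) : Prop :=
  ∃ z : Fin (n + 1) → I.α, z 0 = x ∧ z (Fin.last n) = y ∧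
    ∀ i : Fin n, Adj I (z i.castSucc) (z i.succ)

/-- The distance between two elements, in `ℕ∞`. -/
noncomputable def dist (I : Interp Cn Rn) (x y : I.α) : ℕ∞ :=
  sInf ((fun n : ℕ => (n : ℕ∞)) '' {n | ChainLen I n x y})

/-- The `k`-neighbourhood of `x`. -/
def Nbhd (I : Interp Cn Rn) (k : ℕ) (x : I.α) : Set I.α :=
  {y | dist I x y ≤ (k : ℕ∞)}

/-- The induced subinterpretation on a subset of the domain. -/
abbrev restrict (I : Interp Cn Rn) (Δ : Set I.α) : Interp Cn Rn where
  α := Δ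
  A := fun c => {a | (a : I.α) ∈ I.A c}
  r := fun s a b => I.r s (a : I.α) (b : I.α)

lemma mem_nbhd_self (I : Interp Cn Rn) (k : ℕ) (x : I.α) : x ∈ Nbhd I k x := by
  have h0 : ChainLen I 0 x x := ⟨fun _ => x, rfl, rfl, fun i => i.elim0⟩
  have h1 : dist I x x ≤ ((0 : ℕ) : ℕ∞) := sInf_le ⟨0, h0, rfl⟩
  exact le_trans h1 (by exact_mod_cast Nat.zero_le k)

/-- Colour-preserving homomorphism between coloured interpretations. -/
def ColourHom (I J : Interp Cn Rn) (κ : I.α → Option Γ) (θ : J.α → Option Γ)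
    (h : I.α → J.α) : Prop :=
  IsHom I J h ∧ (∀ x, κ x = none ↔ θ (h x) = none) ∧
  (∀ x γ, κ x = some γ → θ (h x) = some γ)

/-- The `k`-neighbourhood equivalence on the domain of a coloured interpretation. -/
def NbhdEquiv (I : Interp Cn Rn) (κ : I.α → Option Γ) (k : ℕ) (x y : I.α) : Prop :=
  x = y ∨
  ((∃ γ, κ x = some γ ∧ κ y = some γ) ∧
   (∃ h : (I.restrict (Nbhd I k x)).α → (I.restrict (Nbhd I k y)).α,
      ColourHom (I.restrict (Nbhd I k x)) (I.restrict (Nbhd I k y))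
        (fun a => κ a.val) (fun a => κ a.val) h ∧
      (h ⟨x, mem_nbhd_self I k x⟩ : I.α) = y) ∧
   (∃ g : (I.restrict (Nbhd I k y)).α → (I.restrict (Nbhd I k x)).α,
      ColourHom (I.restrict (Nbhd I k y)) (I.restrict (Nbhd I k x))
        (fun a => κ a.val) (fun a => κ a.val) g ∧
      (g ⟨y, mem_nbhd_self I k y⟩ : I.α) = x))

/-- `(I, κ)` is `k`-sparse. -/
def Sparse (I : Interp Cn Rn) (κ : I.α → Option Γ) (k : ℕ) : Prop :=
  ∀ x y y' : I.α, y ∈ Nbhd I k x → y' ∈ Nbhd I k x →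
    (∃ γ, κ y = some γ) → (∃ γ', κ y' = some γ') → y ≠ y' → κ y ≠ κ y'

/-- The quotient of an interpretation by a relation on its domain. -/
def quot (I : Interp Cn Rn) (R : I.α → I.α → Prop) : Interp Cn Rn where
  α := Quot R
  A := fun c => {q | ∃ x, q = Quot.mk R x ∧ x ∈ I.A c}
  r := fun s p q => ∃ x y, p = Quot.mk R x ∧ q = Quot.mk R y ∧ I.r s x y

end Interp

/-- Greedy colouring along a well-order: a symmetric relation under which every element is related
to fewer than `N` other elements has a proper colouring with colours below `N`. -/
theorem exists_nat_colouring_of_ncard_lt {α : Type*} (R : α → α → Prop)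
    (hR : ∀ x y, R x y → R y x) (N : ℕ)
    (hN : ∀ x, {y | R x y ∧ y ≠ x}.Finite ∧ {y | R x y ∧ y ≠ x}.ncard < N) :
    ∃ c : α → ℕ, (∀ x, c x < N) ∧ ∀ x y, R x y → x ≠ y → c x ≠ c y := by
  have wf : WellFounded (WellOrderingRel : α → α → Prop) := WellOrderingRel.isWellOrder.wf
  let c : α → ℕ := wf.fix fun x c => sInf {n | ∀ y (h : WellOrderingRel y x), R x y → c y h ≠ n}
  have hc (x : α) : c x = sInf {n | ∀ y, WellOrderingRel y x → R x y → c y ≠ n} :=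
    wf.fix_eq _ x
  have free (x : α) : ∃ n < N, ∀ y, WellOrderingRel y x → R x y → c y ≠ n := by
    have hlt : (c '' {y | R x y ∧ y ≠ x}).ncard < (Set.Iio N).ncard := by
      have h : (Set.Iio N).ncard = N := by simp [Set.ncard_eq_toFinset_card']
      rw [h]
      exact (Set.ncard_image_le (hN x).1).trans_lt (hN x).2
    obtain ⟨n, hn, hn'⟩ := Set.exists_mem_notMem_of_ncard_lt_ncard hlt ((hN x).1.image c)
    refine ⟨n, hn, fun y hy hxy hcy => hn' ⟨y, ⟨hxy, ?_⟩, hcy⟩⟩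
    rintro rfl
    exact wf.irrefl.irrefl y hy
  have ne_of_lt (x y : α) (hy : WellOrderingRel y x) (hxy : R x y) : c y ≠ c x := by
    obtain ⟨n, -, hn⟩ := free x
    have hmem := Nat.sInf_mem (s := {n | ∀ y, WellOrderingRel y x → R x y → c y ≠ n}) ⟨n, hn⟩
    rw [← hc] at hmem
    exact hmem y hy hxy
  refine ⟨c, fun x => ?_, fun x y hxy hne => ?_⟩
  · obtain ⟨n, hnN, hn⟩ := free x
    rw [hc]
    exact (Nat.sInf_le (Set.mem_ofPred.2 hn)).trans_lt hnN
  · rcases trichotomous_of WellOrderingRel x y with h | h | h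
    · exact ne_of_lt y x h (hR x y hxy)
    · exact absurd h hne
    · exact (ne_of_lt x y h hxy).symm

namespace Interp

variable {Cn Rn : Type} {I : Interp Cn Rn}

theorem Adj.symm {x y : I.α} (h : Adj I x y) : Adj I y x :=
  let ⟨s, hs⟩ := h
  ⟨s, hs.symm⟩

theorem chainLen_zero_iff {x y : I.α} : ChainLen I 0 x y ↔ x = y := by
  constructor
  · rintro ⟨z, rfl, rfl, -⟩
    rfl
  · rintro rfl
    exact ⟨fun _ => x, rfl, rfl, fun i => i.elim0⟩

theorem chainLen_succ_iff {n : ℕ} {x y : I.α} :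
    ChainLen I (n + 1) x y ↔ ∃ w, ChainLen I n x w ∧ Adj I w y := by
  constructor
  · rintro ⟨z, rfl, rfl, hz⟩
    exact ⟨z (Fin.last n).castSucc, ⟨fun i => z i.castSucc, rfl, rfl, fun i => hz i.castSucc⟩,
      hz (Fin.last n)⟩
  · rintro ⟨w, ⟨z, rfl, rfl, hz⟩, hwy⟩
    refine ⟨Fin.snoc (α := fun _ => I.α) z y, ?_, Fin.snoc_last .., fun i => ?_⟩
    · exact Fin.snoc_castSucc (α := fun _ => I.α) y z 0
    · induction i using Fin.lastCases with
      | last => rwa [Fin.succ_last, Fin.snoc_last, Fin.snoc_castSucc]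
      | cast i =>
        rw [Fin.succ_castSucc, Fin.snoc_castSucc, Fin.snoc_castSucc]
        exact hz i

theorem ChainLen.symm {n : ℕ} {x y : I.α} (h : ChainLen I n x y) : ChainLen I n y x := by
  obtain ⟨z, rfl, rfl, hz⟩ := h
  refine ⟨fun i => z i.rev, by simp, by simp, fun i => ?_⟩
  beta_reduce
  rw [Fin.rev_castSucc, Fin.rev_succ]
  exact (hz i.rev).symm

theorem ChainLen.trans {m n : ℕ} {x y w : I.α} (h : ChainLen I m x y) (h' : ChainLen I n y w) :
    ChainLen I (m + n) x w := by
  induction n generalizing w with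
  | zero =>
    obtain rfl := chainLen_zero_iff.1 h'
    exact h
  | succ n ih =>
    obtain ⟨v, hv, hvw⟩ := chainLen_succ_iff.1 h'
    exact chainLen_succ_iff.2 ⟨v, ih hv, hvw⟩

theorem exists_chainLen_of_mem_nbhd {k : ℕ} {x y : I.α} (h : y ∈ Nbhd I k x) :
    ∃ n ≤ k, ChainLen I n x y := by
  have hlt : dist I x y < ((k + 1 : ℕ) : ℕ∞) :=
    lt_of_le_of_lt h (by exact_mod_cast Nat.lt_succ_self k)
  obtain ⟨-, ⟨n, hn, rfl⟩, hnk⟩ := sInf_lt_iff.1 hlt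
  exact ⟨n, Nat.lt_succ_iff.1 (Nat.cast_lt.1 hnk), hn⟩

open Classical in
theorem exists_finset_chainLen {d : ℕ}
    (hdeg : ∀ x : I.α, {y | Adj I x y}.Finite ∧ {y | Adj I x y}.ncard ≤ d) (n : ℕ) (x : I.α) :
    ∃ s : Finset I.α, (∀ y, y ∈ s ↔ ChainLen I n x y) ∧ s.card ≤ d ^ n := by
  induction n with
  | zero => exact ⟨{x}, fun y => by rw [chainLen_zero_iff, Finset.mem_singleton, eq_comm], by simp⟩
  | succ n ih =>
    obtain ⟨s, hs, hcard⟩ := ih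
    refine ⟨s.biUnion fun w => (hdeg w).1.toFinset, fun y => ?_, ?_⟩
    · simp [chainLen_succ_iff, hs]
    · rw [pow_succ]
      refine (Finset.card_biUnion_le_card_mul _ _ d fun w _ => ?_).trans
        (Nat.mul_le_mul_right d hcard)
      rw [← Set.ncard_eq_toFinset_card _ (hdeg w).1]
      exact (hdeg w).2

open Classical in
theorem exists_finset_chainLen_le {d : ℕ}
    (hdeg : ∀ x : I.α, {y | Adj I x y}.Finite ∧ {y | Adj I x y}.ncard ≤ d) (k : ℕ) (x : I.α) :
    ∃ s : Finset I.α, (∀ y, y ∈ s ↔ ∃ n ≤ k, ChainLen I n x y) ∧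
      s.card ≤ ∑ i ∈ Finset.range (k + 1), d ^ i := by
  choose s hs hcard using fun n => exists_finset_chainLen hdeg n x
  refine ⟨(Finset.range (k + 1)).biUnion s, fun y => ?_, ?_⟩
  · simp [hs]
  · exact Finset.card_biUnion_le.trans (Finset.sum_le_sum fun i _ => hcard i)

end Interp

open Interp in
/-- Existence of sparse colourings for bounded-degree interpretations: if every element
has at most `d` adjacent elements, then for every subset `F` and every `ℓ` there is a
partial colouring with domain exactly `F` which is `ℓ`-sparse and uses at most
`1 + d + d² + ⋯ + d^(2ℓ)` colours (every used colour lies below this bound). -/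
theorem sparse_colouring_exists {Cn Rn : Type} (I : Interp Cn Rn) (d : ℕ)
    (hdeg : ∀ x : I.α, {y | Adj I x y}.Finite ∧ {y | Adj I x y}.ncard ≤ d)
    (F : Set I.α) (ℓ : ℕ) :
    ∃ κ : I.α → Option ℕ,
      (∀ x, (∃ n, κ x = some n) ↔ x ∈ F) ∧
      Sparse I κ ℓ ∧
      (∀ x n, κ x = some n → n < ∑ i ∈ Finset.range (2 * ℓ + 1), d ^ i) := by
  classical
  obtain ⟨c, hcN, hc⟩ := exists_nat_colouring_of_ncard_lt
    (fun x y : I.α => ∃ n ≤ 2 * ℓ, ChainLen I n x y)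
    (fun x y ⟨n, hn, h⟩ => ⟨n, hn, h.symm⟩) (∑ i ∈ Finset.range (2 * ℓ + 1), d ^ i) (by
      intro x
      obtain ⟨s, hs, hcard⟩ := exists_finset_chainLen_le hdeg (2 * ℓ) x
      have hx : x ∈ s := (hs x).2 ⟨0, Nat.zero_le _, chainLen_zero_iff.2 rfl⟩
      have heq : {y | (∃ n ≤ 2 * ℓ, ChainLen I n x y) ∧ y ≠ x} = (s.erase x : Finset I.α) := by
        ext y
        rw [Finset.mem_coe, Finset.mem_erase, hs, and_comm]
        rfl
      rw [heq, Set.ncard_coe_finset]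
      exact ⟨Finset.finite_toSet _, (Finset.card_erase_lt_of_mem hx).trans_le hcard⟩)
  refine ⟨fun x => if x ∈ F then some (c x) else none, fun x => ?_, ?_, fun x n h => ?_⟩
  · by_cases hx : x ∈ F <;> simp [hx]
  · rintro x y y' hy hy' ⟨γ, hγ⟩ ⟨γ', hγ'⟩ hne
    obtain ⟨m, hm, hxy⟩ := exists_chainLen_of_mem_nbhd hy
    obtain ⟨n, hn, hxy'⟩ := exists_chainLen_of_mem_nbhd hy'
    have hF : y ∈ F := (Option.ite_none_right_eq_some.1 hγ).1
    have hF' : y' ∈ F := (Option.ite_none_right_eq_some.1 hγ').1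
    simpa [hF, hF'] using hc y y' ⟨m + n, by omega, hxy.symm.trans hxy'⟩ hne
  · obtain ⟨-, h⟩ := Option.ite_none_right_eq_some.1 h
    obtain rfl := Option.some.inj h
    exact hcN x
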